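/- arXiv:2511.18064 — 2 statements merged into one kernel-verified Lean document; each statement's English description precedes it below -/
import Mathlib

section
/- Let G be an infinite commutative group, f : G → ℝ a bounded function, and α a real number with M_*(f) ≤ α ≤ M*(f). Then there exists a full mean M on G (a functional on bounded functions that is simultaneously an upper mean and a lower mean) such that M(f) = α. -/
open scoped Pointwise BigOperators
open Filter

/-- A real function on `G` is bounded. -/
def Bounded {G : Type*} (f : G → ℝ) : Prop :=
  ∃ C : ℝ, ∀ x, |f x| ≤ C

/-- An upper mean on the bounded real functions on a commutative group `G`. -/
structure IsUpperMean (G : Type*) [AddCommGroup G] (M : (G → ℝ) → ℝ) : Prop where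
  norming : ∀ c : ℝ, M (fun _ => c) = c
  mono : ∀ f g : G → ℝ, Bounded f → Bounded g → (∀ x, f x ≤ g x) → M f ≤ M g
  homog : ∀ c : ℝ, 0 ≤ c → ∀ f : G → ℝ, Bounded f → M (fun x => c * f x) = c * M f
  restr_add : ∀ f : G → ℝ, Bounded f → ∀ t : G, M (fun x => f x + f (x + t)) = 2 * M f
  subadd : ∀ f g : G → ℝ, Bounded f → Bounded g → M (fun x => f x + g x) ≤ M f + M g

/-- A lower mean on the bounded real functions on a commutative group `G`. -/
structure IsLowerMean (G : Type*) [AddCommGroup G] (M : (G → ℝ) → ℝ) : Prop where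
  norming : ∀ c : ℝ, M (fun _ => c) = c
  mono : ∀ f g : G → ℝ, Bounded f → Bounded g → (∀ x, f x ≤ g x) → M f ≤ M g
  homog : ∀ c : ℝ, 0 ≤ c → ∀ f : G → ℝ, Bounded f → M (fun x => c * f x) = c * M f
  restr_add : ∀ f : G → ℝ, Bounded f → ∀ t : G, M (fun x => f x + f (x + t)) = 2 * M f
  superadd : ∀ f g : G → ℝ, Bounded f → Bounded g → M f + M g ≤ M (fun x => f x + g x)

/-- `f` and `f'` are commarginal: marginals of a bounded `F` supported near the diagonal. -/
def Commarginal {G : Type*} [AddCommGroup G] (f f' : G → ℝ) : Prop :=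
  ∃ (F : G → G → ℝ) (B : Finset G),
    (∃ C : ℝ, ∀ x y, |F x y| ≤ C) ∧
    (∀ x y, F x y ≠ 0 → x - y ∈ B) ∧
    (∀ x, ∑ᶠ y, F x y = f x) ∧
    (∀ y, ∑ᶠ x, F x y = f' y)

/-- Uniform convergence of a sequence of functions. -/
def UnifLim {G : Type*} (g : ℕ → G → ℝ) (f : G → ℝ) : Prop :=
  ∀ ε : ℝ, 0 < ε → ∃ N : ℕ, ∀ n ≥ N, ∀ x, |g n x - f x| < ε

/-- `f` and `f'` are limit-commarginal. -/
def LimitCommarginal {G : Type*} [AddCommGroup G] (f f' : G → ℝ) : Prop :=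
  ∃ g g' : ℕ → G → ℝ, (∀ n, Bounded (g n)) ∧ (∀ n, Bounded (g' n)) ∧
    (∀ n, Commarginal (g n) (g' n)) ∧ UnifLim g f ∧ UnifLim g' f'

/-- `g` is a finite convex combination of translates of `f`. -/
def ConvexCombTranslates {G : Type*} [AddCommGroup G] (f g : G → ℝ) : Prop :=
  ∃ (n : ℕ) (c : Fin n → ℝ) (t : Fin n → G),
    (∀ i, 0 ≤ c i) ∧ (∑ i, c i) = 1 ∧ ∀ x, g x = ∑ i, c i * f (x + t i)

/-- The uppermost mean `M*`. -/
noncomputable def Mstar {G : Type*} [AddCommGroup G] (f : G → ℝ) : ℝ :=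
  sInf {a : ℝ | ∃ g : G → ℝ, ConvexCombTranslates f g ∧ a = sSup (Set.range g)}

/-- The lowest mean `M_*`. -/
noncomputable def Mlowstar {G : Type*} [AddCommGroup G] (f : G → ℝ) : ℝ :=
  sSup {a : ℝ | ∃ g : G → ℝ, ConvexCombTranslates f g ∧ a = sInf (Set.range g)}

/-- The `B`-average `(f|B)(t)` of `f`. -/
noncomputable def avg {G : Type*} [AddCommGroup G] (f : G → ℝ) (B : Finset G) (t : G) : ℝ :=
  (∑ b ∈ B, f (b + t)) / (B.card : ℝ)

/-- The expansion pseudomean `E(f)`. -/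
noncomputable def Epm {G : Type*} [AddCommGroup G] [DecidableEq G] (f : G → ℝ) : ℝ :=
  ⨅ T : {T : Finset G // T.Nonempty}, ⨆ B : {B : Finset G // B.Nonempty},
    (∑ b ∈ B.1, f b) / (((B.1 + T.1).card : ℝ))

/-- A finite nonempty `Y ⊆ G` is a tile: some set `Z` of translates partitions `G`. -/
def IsTile {G : Type*} [AddCommGroup G] (Y : Finset G) : Prop :=
  Y.Nonempty ∧ ∃ Z : Set G, ∀ x : G, ∃! p : Y × Z, (p.1 : G) + (p.2 : G) = x

section UppermostMean

variable {G : Type*}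

/-- The bounded real functions on `G`, as a submodule of all real functions. -/
def boundedSubmodule (G : Type*) : Submodule ℝ (G → ℝ) where
  carrier := {f | Bounded f}
  zero_mem' := ⟨0, fun x => by simp⟩
  add_mem' := by
    rintro f g ⟨C, hC⟩ ⟨D, hD⟩
    exact ⟨C + D, fun x => (abs_add_le _ _).trans (add_le_add (hC x) (hD x))⟩
  smul_mem' := by
    rintro c f ⟨C, hC⟩
    refine ⟨|c| * C, fun x => ?_⟩
    simpa [abs_mul] using mul_le_mul_of_nonneg_left (hC x) (abs_nonneg c)

variable [AddCommGroup G]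

theorem Bounded.translate {f : G → ℝ} (hf : Bounded f) (t : G) : Bounded fun x => f (x + t) :=
  let ⟨C, hC⟩ := hf
  ⟨C, fun x => hC (x + t)⟩

theorem ConvexCombTranslates.bounded {f g : G → ℝ} {C : ℝ} (hC : ∀ x, |f x| ≤ C)
    (h : ConvexCombTranslates f g) (x : G) : |g x| ≤ C := by
  obtain ⟨n, c, t, hc, hsum, hg⟩ := h
  rw [hg]
  calc |∑ i, c i * f (x + t i)| ≤ ∑ i, |c i * f (x + t i)| := Finset.abs_sum_le_sum_abs _ _
    _ ≤ ∑ i, c i * C := Finset.sum_le_sum fun i _ => by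
        rw [abs_mul, abs_of_nonneg (hc i)]
        exact mul_le_mul_of_nonneg_left (hC _) (hc i)
    _ = C := by rw [← Finset.sum_mul, hsum, one_mul]

theorem convexCombTranslates_of_fintype {ι : Type*} [Fintype ι] (f : G → ℝ) (c : ι → ℝ) (t : ι → G)
    (hc : ∀ i, 0 ≤ c i) (hsum : ∑ i, c i = 1) :
    ConvexCombTranslates f fun x => ∑ i, c i * f (x + t i) := by
  let e := (Fintype.equivFin ι).symm
  exact ⟨Fintype.card ι, c ∘ e, t ∘ e, fun i => hc _, (e.sum_comp c).trans hsum,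
    fun x => (e.sum_comp fun i => c i * f (x + t i)).symm⟩

theorem Mstar_le {ι : Type*} [Fintype ι] {f : G → ℝ} (hf : Bounded f) {c : ι → ℝ} {t : ι → G}
    (hc : ∀ i, 0 ≤ c i) (hsum : ∑ i, c i = 1) {a : ℝ}
    (ha : ∀ x, ∑ i, c i * f (x + t i) ≤ a) : Mstar f ≤ a := by
  obtain ⟨C, hC⟩ := hf
  have hbdd : BddBelow {a : ℝ | ∃ g : G → ℝ, ConvexCombTranslates f g ∧ a = sSup (Set.range g)} := by
    refine ⟨-C, ?_⟩
    rintro _ ⟨g, hg, rfl⟩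
    have hgC := hg.bounded hC
    exact (abs_le.1 (hgC 0)).1.trans
      (le_csSup ⟨C, Set.forall_mem_range.2 fun x => (abs_le.1 (hgC x)).2⟩ ⟨0, rfl⟩)
  exact (csInf_le hbdd ⟨_, convexCombTranslates_of_fintype f c t hc hsum, rfl⟩).trans
    (csSup_le (Set.range_nonempty _) (Set.forall_mem_range.2 ha))

theorem le_Mlowstar {ι : Type*} [Fintype ι] {f : G → ℝ} (hf : Bounded f) {c : ι → ℝ} {t : ι → G}
    (hc : ∀ i, 0 ≤ c i) (hsum : ∑ i, c i = 1) {a : ℝ}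
    (ha : ∀ x, a ≤ ∑ i, c i * f (x + t i)) : a ≤ Mlowstar f := by
  obtain ⟨C, hC⟩ := hf
  have hbdd : BddAbove {a : ℝ | ∃ g : G → ℝ, ConvexCombTranslates f g ∧ a = sInf (Set.range g)} := by
    refine ⟨C, ?_⟩
    rintro _ ⟨g, hg, rfl⟩
    have hgC := hg.bounded hC
    exact (csInf_le ⟨-C, Set.forall_mem_range.2 fun x => (abs_le.1 (hgC x)).1⟩ ⟨0, rfl⟩).trans
      (abs_le.1 (hgC 0)).2
  exact (le_csInf (Set.range_nonempty _) (Set.forall_mem_range.2 ha)).trans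
    (le_csSup hbdd ⟨_, convexCombTranslates_of_fintype f c t hc hsum, rfl⟩)

theorem exists_convexComb_le_Mstar_add {f : G → ℝ} (hf : Bounded f) {ε : ℝ} (hε : 0 < ε) :
    ∃ (n : ℕ) (c : Fin n → ℝ) (t : Fin n → G), (∀ i, 0 ≤ c i) ∧ ∑ i, c i = 1 ∧
      ∀ x, ∑ i, c i * f (x + t i) ≤ Mstar f + ε := by
  obtain ⟨C, hC⟩ := hf
  have hne : {a : ℝ | ∃ g : G → ℝ, ConvexCombTranslates f g ∧ a = sSup (Set.range g)}.Nonempty :=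
    ⟨_, _, convexCombTranslates_of_fintype f (fun _ : Unit => 1) (fun _ => 0) (by simp) (by simp),
      rfl⟩
  obtain ⟨_, ⟨g, hg, rfl⟩, hlt⟩ := exists_lt_of_csInf_lt hne (lt_add_of_pos_right (Mstar f) hε)
  have hgC := hg.bounded hC
  obtain ⟨n, c, t, hc, hsum, hgx⟩ := hg
  refine ⟨n, c, t, hc, hsum, fun x => ?_⟩
  rw [← hgx]
  exact (le_csSup ⟨C, Set.forall_mem_range.2 fun x => (abs_le.1 (hgC x)).2⟩ ⟨x, rfl⟩).trans hlt.le

theorem Mstar_le_of_le {f : G → ℝ} (hf : Bounded f) {a : ℝ} (ha : ∀ x, f x ≤ a) : Mstar f ≤ a :=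
  Mstar_le (ι := Unit) (c := fun _ => 1) (t := fun _ => 0) hf (by simp) (by simp) (by simpa using ha)

theorem Mstar_add_le {f g : G → ℝ} (hf : Bounded f) (hg : Bounded g) :
    Mstar (f + g) ≤ Mstar f + Mstar g := by
  refine le_of_forall_pos_le_add fun ε hε => ?_
  obtain ⟨n, c, t, hc, hcs, hct⟩ := exists_convexComb_le_Mstar_add hf (half_pos hε)
  obtain ⟨m, d, s, hd, hds, hdt⟩ := exists_convexComb_le_Mstar_add hg (half_pos hε)
  refine Mstar_le (ι := Fin n × Fin m) (c := fun p => c p.1 * d p.2) (t := fun p => t p.1 + s p.2)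
    ((boundedSubmodule G).add_mem hf hg) (fun p => mul_nonneg (hc _) (hd _)) ?_ fun x => ?_
  · rw [Fintype.sum_prod_type, ← Fintype.sum_mul_sum, hcs, hds, one_mul]
  · have h₁ : ∑ p : Fin n × Fin m, c p.1 * d p.2 * f (x + (t p.1 + s p.2)) ≤ Mstar f + ε / 2 :=
      calc _ = ∑ j, d j * ∑ i, c i * f (x + s j + t i) := by
            rw [Fintype.sum_prod_type_right]
            refine Finset.sum_congr rfl fun j _ => ?_
            rw [Finset.mul_sum]
            refine Finset.sum_congr rfl fun i _ => ?_
            rw [show x + (t i + s j) = x + s j + t i by abel]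
            ring
        _ ≤ ∑ j, d j * (Mstar f + ε / 2) :=
            Finset.sum_le_sum fun j _ => mul_le_mul_of_nonneg_left (hct _) (hd j)
        _ = _ := by rw [← Finset.sum_mul, hds, one_mul]
    have h₂ : ∑ p : Fin n × Fin m, c p.1 * d p.2 * g (x + (t p.1 + s p.2)) ≤ Mstar g + ε / 2 :=
      calc _ = ∑ i, c i * ∑ j, d j * g (x + t i + s j) := by
            rw [Fintype.sum_prod_type]
            refine Finset.sum_congr rfl fun i _ => ?_
            rw [Finset.mul_sum]
            refine Finset.sum_congr rfl fun j _ => ?_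
            rw [← add_assoc]
            ring
        _ ≤ ∑ i, c i * (Mstar g + ε / 2) :=
            Finset.sum_le_sum fun i _ => mul_le_mul_of_nonneg_left (hdt _) (hc i)
        _ = _ := by rw [← Finset.sum_mul, hcs, one_mul]
    simp only [Pi.add_apply, mul_add, Finset.sum_add_distrib]
    linarith

theorem Mstar_smul_le {f : G → ℝ} (hf : Bounded f) {r : ℝ} (hr : 0 < r) :
    Mstar (r • f) ≤ r * Mstar f := by
  refine le_of_forall_pos_le_add fun ε hε => ?_
  obtain ⟨n, c, t, hc, hcs, hct⟩ := exists_convexComb_le_Mstar_add hf (div_pos hε hr)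
  refine Mstar_le ((boundedSubmodule G).smul_mem r hf) (t := t) hc hcs fun x => ?_
  calc ∑ i, c i * (r • f) (x + t i) = r * ∑ i, c i * f (x + t i) := by
        rw [Finset.mul_sum]
        exact Finset.sum_congr rfl fun i _ => by simp only [Pi.smul_apply, smul_eq_mul]; ring
    _ ≤ r * (Mstar f + ε / r) := mul_le_mul_of_nonneg_left (hct x) hr.le
    _ = r * Mstar f + ε := by field_simp

theorem Mstar_smul {f : G → ℝ} (hf : Bounded f) {r : ℝ} (hr : 0 < r) :
    Mstar (r • f) = r * Mstar f := by
  refine (Mstar_smul_le hf hr).antisymm ?_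
  have h := Mstar_smul_le ((boundedSubmodule G).smul_mem r hf) (inv_pos.2 hr)
  rw [smul_smul, inv_mul_cancel₀ hr.ne', one_smul] at h
  calc r * Mstar f ≤ r * (r⁻¹ * Mstar (r • f)) := mul_le_mul_of_nonneg_left h hr.le
    _ = Mstar (r • f) := by field_simp

theorem neg_Mlowstar_le {f : G → ℝ} (hf : Bounded f) : -Mlowstar f ≤ Mstar (-f) := by
  refine le_of_forall_pos_le_add fun ε hε => ?_
  obtain ⟨n, c, t, hc, hcs, hct⟩ :=
    exists_convexComb_le_Mstar_add ((boundedSubmodule G).neg_mem hf) hε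
  have h : -(Mstar (-f) + ε) ≤ Mlowstar f := le_Mlowstar hf (t := t) hc hcs fun x => by
    have := hct x
    simp only [Pi.neg_apply, mul_neg, Finset.sum_neg_distrib] at this
    linarith
  linarith

theorem Mstar_translate_sub_le {f : G → ℝ} (hf : Bounded f) (t : G) :
    Mstar ((fun x => f (x + t)) - f) ≤ 0 := by
  have hb : Bounded ((fun x => f (x + t)) - f) :=
    (boundedSubmodule G).sub_mem (hf.translate t) hf
  obtain ⟨C, hC⟩ := hf
  have key : ∀ n : ℕ, Mstar ((fun x => f (x + t)) - f) ≤ 2 * C / ((n : ℝ) + 1) := fun n => by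
    have hn : (0 : ℝ) < (n : ℝ) + 1 := by positivity
    refine Mstar_le (ι := Fin (n + 1)) (c := fun _ => ((n : ℝ) + 1)⁻¹) (t := fun i => (i : ℕ) • t)
      hb (fun _ => (inv_pos.2 hn).le) ?_ fun x => ?_
    · simp [hn.ne']
    · have htel : ∑ i : Fin (n + 1), ((fun x => f (x + t)) - f) (x + (i : ℕ) • t)
          = f (x + (n + 1) • t) - f x := by
        rw [Fin.sum_univ_eq_sum_range (fun i => ((fun x => f (x + t)) - f) (x + i • t))]
        simpa [add_assoc, succ_nsmul] using
          Finset.sum_range_sub (fun i => f (x + i • t)) (n + 1)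
      rw [← Finset.mul_sum, htel, div_eq_inv_mul]
      refine mul_le_mul_of_nonneg_left ?_ (inv_pos.2 hn).le
      have h₁ := (abs_le.1 (hC (x + (n + 1) • t))).2
      have h₂ := (abs_le.1 (hC x)).1
      linarith
  have hlim : Tendsto (fun n : ℕ => 2 * C / ((n : ℝ) + 1)) atTop (nhds 0) :=
    tendsto_const_nhds.div_atTop
      (tendsto_atTop_add_const_right _ _ tendsto_natCast_atTop_atTop)
  exact ge_of_tendsto' hlim key

theorem mul_le_Mstar_smul {f : G → ℝ} (hf : Bounded f) {α : ℝ} (h1 : Mlowstar f ≤ α)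
    (h2 : α ≤ Mstar f) (c : ℝ) : c * α ≤ Mstar (c • f) := by
  rcases lt_trichotomy c 0 with hc | rfl | hc
  · have h := Mstar_smul ((boundedSubmodule G).neg_mem hf) (neg_pos.2 hc)
    rw [smul_neg, neg_smul, neg_neg] at h
    rw [h]
    nlinarith [neg_Mlowstar_le hf]
  · have h := neg_Mlowstar_le (boundedSubmodule G).zero_mem
    have h' : (0 : ℝ) ≤ Mstar (0 : G → ℝ) := by
      have := Mstar_smul (boundedSubmodule G).zero_mem (two_pos (α := ℝ))
      rw [smul_zero] at this
      linarith
    simpa using h'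
  · rw [Mstar_smul hf hc]
    exact mul_le_mul_of_nonneg_left h2 hc.le

/-- A linear functional dominated by the uppermost mean is a full mean. -/
theorem exists_full_mean_of_le_Mstar (φ : boundedSubmodule G →ₗ[ℝ] ℝ)
    (hφ : ∀ g : boundedSubmodule G, φ g ≤ Mstar (g : G → ℝ)) :
    ∃ M : (G → ℝ) → ℝ, IsUpperMean G M ∧ IsLowerMean G M ∧
      ∀ (g : G → ℝ) (hg : Bounded g), M g = φ ⟨g, hg⟩ := by
  classical
  let M : (G → ℝ) → ℝ := fun g => if hg : Bounded g then φ ⟨g, hg⟩ else 0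
  have hM : ∀ (g : G → ℝ) (hg : Bounded g), M g = φ ⟨g, hg⟩ := fun g hg => dif_pos hg
  have hle : ∀ (g : G → ℝ) (_ : Bounded g) (a : ℝ), (∀ x, g x ≤ a) → M g ≤ a := fun g hg a ha =>
    (hM g hg).trans_le ((hφ _).trans (Mstar_le_of_le hg ha))
  have hsmul : ∀ (c : ℝ) (g : G → ℝ), Bounded g → M (fun x => c * g x) = c * M g := fun c g hg => by
    rw [hM g hg, ← smul_eq_mul, ← map_smul]
    exact hM _ ((boundedSubmodule G).smul_mem c hg)
  have hadd : ∀ g h : G → ℝ, Bounded g → Bounded h → M (fun x => g x + h x) = M g + M h :=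
    fun g h hg hh => by
      rw [hM g hg, hM h hh, ← map_add]
      exact hM _ ((boundedSubmodule G).add_mem hg hh)
  have hsub : ∀ g h : G → ℝ, Bounded g → Bounded h → M (g - h) = M g - M h :=
    fun g h hg hh => by
      rw [hM g hg, hM h hh, ← map_sub]
      exact hM _ ((boundedSubmodule G).sub_mem hg hh)
  have hconst : ∀ c : ℝ, Bounded fun _ : G => c := fun c => ⟨|c|, fun _ => le_rfl⟩
  have hnorm : ∀ c : ℝ, M (fun _ => c) = c := fun c => by
    refine (hle _ (hconst c) c fun _ => le_rfl).antisymm ?_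
    have h₁ := hle _ (hconst (-1 * c)) (-c) fun _ => by simp
    rw [hsmul (-1) (fun _ => c) (hconst c)] at h₁
    linarith
  have hmono : ∀ g h : G → ℝ, Bounded g → Bounded h → (∀ x, g x ≤ h x) → M g ≤ M h :=
    fun g h hg hh hgh => by
      have h₁ := hle (g - h) ((boundedSubmodule G).sub_mem hg hh) 0 fun x => sub_nonpos.2 (hgh x)
      rw [hsub g h hg hh] at h₁
      linarith
  have htrans_le : ∀ g : G → ℝ, Bounded g → ∀ t : G, M (fun x => g (x + t)) ≤ M g :=
    fun g hg t => by
      have h₁ := (hφ ⟨_, (boundedSubmodule G).sub_mem (hg.translate t) hg⟩).trans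
        (Mstar_translate_sub_le hg t)
      rw [← hM _ ((boundedSubmodule G).sub_mem (hg.translate t) hg),
        hsub _ _ (hg.translate t) hg] at h₁
      linarith
  have htrans : ∀ g : G → ℝ, Bounded g → ∀ t : G, M (fun x => g (x + t)) = M g :=
    fun g hg t => (htrans_le g hg t).antisymm <| by
      simpa using htrans_le _ (hg.translate t) (-t)
  have hrestr : ∀ g : G → ℝ, Bounded g → ∀ t : G, M (fun x => g x + g (x + t)) = 2 * M g :=
    fun g hg t => by rw [hadd _ _ hg (hg.translate t), htrans g hg t, two_mul]
  exact ⟨M, ⟨hnorm, hmono, fun c _ => hsmul c, hrestr, fun g h hg hh => (hadd g h hg hh).le⟩,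
    ⟨hnorm, hmono, fun c _ => hsmul c, hrestr, fun g h hg hh => (hadd g h hg hh).ge⟩, hM⟩

end UppermostMean

/-- every value in `[M_*(f), M*(f)]` is attained as the value of `f` under
some full mean. -/
theorem stmt16 {G : Type*} [AddCommGroup G] [Infinite G]
    (f : G → ℝ) (hf : Bounded f) (α : ℝ)
    (h1 : Mlowstar f ≤ α) (h2 : α ≤ Mstar f) :
    ∃ M : (G → ℝ) → ℝ, IsUpperMean G M ∧ IsLowerMean G M ∧ M f = α := by
  have hle := mul_le_Mstar_smul hf h1 h2
  let v : boundedSubmodule G := ⟨f, hf⟩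
  have hwell : ∀ c : ℝ, c • v = 0 → c • α = 0 := fun c hc => by
    have hcf : c • f = 0 := congrArg Subtype.val hc
    have hzero : Mstar (0 : G → ℝ) ≤ 0 :=
      Mstar_le_of_le (boundedSubmodule G).zero_mem fun _ => le_rfl
    have hpos := hle c
    have hneg := hle (-c)
    rw [neg_smul, hcf, neg_zero] at hneg
    rw [hcf] at hpos
    rw [smul_eq_mul]
    linarith
  obtain ⟨φ, hφ, hφle⟩ := exists_extension_of_le_sublinear
    (LinearPMap.mkSpanSingleton' (σ := RingHom.id ℝ) v α hwell) (fun g => Mstar (g : G → ℝ))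
    (fun c hc g => Mstar_smul g.2 hc) (fun g h => Mstar_add_le g.2 h.2) (by
      rintro ⟨g, hg⟩
      obtain ⟨c, rfl⟩ := Submodule.mem_span_singleton.1 hg
      rw [LinearPMap.mkSpanSingleton'_apply]
      exact hle c)
  obtain ⟨M, hU, hL, hM⟩ := exists_full_mean_of_le_Mstar φ hφle
  refine ⟨M, hU, hL, (hM f hf).trans ?_⟩
  have hv : v ∈ (LinearPMap.mkSpanSingleton' (σ := RingHom.id ℝ) v α hwell).domain :=
    Submodule.mem_span_singleton_self v
  exact (hφ ⟨v, hv⟩).trans (LinearPMap.mkSpanSingleton'_apply_self v α hwell hv)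
end

section
/- Let G be an infinite commutative group and A ⊆ G a set with positive uppermost density, d*(A) > 0. Then ⌈1 / d_*(A−A)⌉ ≤ ⌊1 / d*(A)⌋, where A − A = { a − a' : a, a' ∈ A }; consequently d_*(A−A) ≥ d*(A). -/
open scoped Pointwise BigOperators
open Filter

/-- The average of the translates of `f` by a nonempty finite set is a convex combination. -/
theorem convexCombTranslates_average {G : Type*} [AddCommGroup G] (f : G → ℝ) {T : Finset G}
    (hT : T.Nonempty) :
    ConvexCombTranslates f fun x => (T.card : ℝ)⁻¹ * ∑ t ∈ T, f (x + t) := by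
  have hcard : (T.card : ℝ) ≠ 0 := by exact_mod_cast hT.card_ne_zero
  refine ⟨T.card, fun _ => (T.card : ℝ)⁻¹, fun i => (T.equivFin.symm i : G),
    fun _ => by positivity, ?_, fun x => ?_⟩
  · simp [hcard]
  · beta_reduce
    rw [← Finset.mul_sum, ← Finset.sum_coe_sort T fun t => f (x + t)]
    congr 1
    exact (Equiv.sum_comp T.equivFin.symm fun t : T => f (x + t)).symm

/-- A convex combination of translates of a nonnegative function is nonnegative. -/
theorem ConvexCombTranslates.nonneg {G : Type*} [AddCommGroup G] {f g : G → ℝ}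
    (h : ConvexCombTranslates f g) (hf : ∀ x, 0 ≤ f x) (x : G) : 0 ≤ g x := by
  obtain ⟨n, c, t, hc, -, hg⟩ := h
  rw [hg]
  exact Finset.sum_nonneg fun i _ => mul_nonneg (hc i) (hf _)

/-- A convex combination of translates of a function bounded by `1` is bounded by `1`. -/
theorem ConvexCombTranslates.le_one {G : Type*} [AddCommGroup G] {f g : G → ℝ}
    (h : ConvexCombTranslates f g) (hf : ∀ x, f x ≤ 1) (x : G) : g x ≤ 1 := by
  obtain ⟨n, c, t, hc, hsum, hg⟩ := h
  rw [hg, ← hsum]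
  exact Finset.sum_le_sum fun i _ => mul_le_of_le_one_right (hc i) (hf _)

/-- The uppermost mean of a nonnegative function is at most any upper bound of a convex
combination of its translates. -/
theorem Mstar_le_s19 {G : Type*} [AddCommGroup G] {f g : G → ℝ} {a : ℝ} (hf : ∀ x, 0 ≤ f x)
    (h : ConvexCombTranslates f g) (hg : ∀ x, g x ≤ a) : Mstar f ≤ a := by
  have hsup : sSup (Set.range g) ≤ a :=
    csSup_le (Set.range_nonempty g) (Set.forall_mem_range.2 hg)
  refine le_trans (csInf_le ⟨0, ?_⟩ ⟨g, h, rfl⟩) hsup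
  rintro _ ⟨k, hk, rfl⟩
  exact Real.sSup_nonneg (Set.forall_mem_range.2 (hk.nonneg hf))

/-- The lowest mean of a function with values in `[0, 1]` is at least any lower bound of a convex
combination of its translates. -/
theorem le_Mlowstar_s19 {G : Type*} [AddCommGroup G] {f g : G → ℝ} {a : ℝ} (hf : ∀ x, 0 ≤ f x)
    (hf_one : ∀ x, f x ≤ 1) (h : ConvexCombTranslates f g) (hg : ∀ x, a ≤ g x) :
    a ≤ Mlowstar f := by
  refine (le_csInf (Set.range_nonempty g) (Set.forall_mem_range.2 hg)).trans
    (le_csSup ⟨1, ?_⟩ ⟨g, h, rfl⟩)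
  rintro _ ⟨k, hk, rfl⟩
  exact (csInf_le ⟨0, Set.forall_mem_range.2 (hk.nonneg hf)⟩ (Set.mem_range_self 0)).trans
    (hk.le_one hf_one 0)

/-- If the translates of `A` by the elements of `T` are pairwise disjoint, then the uppermost
density of `A` is at most `1 / |T|`. -/
theorem Mstar_indicator_le_inv_card {G : Type*} [AddCommGroup G] {A : Set G} {T : Finset G}
    (hT : T.Nonempty) (hdisj : (T : Set G).Pairwise fun s t => s - t ∉ A - A) :
    Mstar (A.indicator fun _ => (1 : ℝ)) ≤ (T.card : ℝ)⁻¹ := by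
  classical
  refine Mstar_le_s19 (fun x => Set.indicator_nonneg (fun _ _ => zero_le_one) x)
    (convexCombTranslates_average _ hT) fun x => mul_le_of_le_one_right (by positivity) ?_
  simp only [Set.indicator_apply, Finset.sum_boole]
  norm_cast
  refine Finset.card_le_one.2 fun s hs t ht => by_contra fun hst => ?_
  rw [Finset.mem_filter] at hs ht
  refine hdisj hs.1 ht.1 hst ⟨x + s, hs.2, x + t, ht.2, ?_⟩
  exact add_sub_add_left_eq_sub s t x

/-- If the translates of `D` by the elements of `-T` cover the group, then the lowest density of `D`
is at least `1 / |T|`. -/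
theorem inv_card_le_Mlowstar_indicator {G : Type*} [AddCommGroup G] {D : Set G} {T : Finset G}
    (hT : T.Nonempty) (hcover : ∀ x, ∃ t ∈ T, x + t ∈ D) :
    (T.card : ℝ)⁻¹ ≤ Mlowstar (D.indicator fun _ => (1 : ℝ)) := by
  have hnonneg : ∀ x, 0 ≤ D.indicator (fun _ => (1 : ℝ)) x :=
    Set.indicator_nonneg fun _ _ => zero_le_one
  refine le_Mlowstar_s19 hnonneg
    (Set.indicator_le_self' (fun _ _ => zero_le_one))
    (convexCombTranslates_average _ hT) fun x => le_mul_of_one_le_right (by positivity) ?_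
  obtain ⟨t, ht, hxt⟩ := hcover x
  calc (1 : ℝ) = D.indicator (fun _ => (1 : ℝ)) (x + t) := by simp [hxt]
    _ ≤ _ := Finset.single_le_sum (f := fun t => D.indicator (fun _ => (1 : ℝ)) (x + t))
      (fun s _ => hnonneg _) ht

/-- If `A` has positive uppermost density, some finite set is maximal among those whose translates
of `A` are pairwise disjoint, and its translates of `A - A` cover the group. -/
theorem exists_disjoint_translates_covering {G : Type*} [AddCommGroup G] {A : Set G}
    (hA : 0 < Mstar (A.indicator fun _ => (1 : ℝ))) :
    ∃ T : Finset G, ((T : Set G).Pairwise fun s t => s - t ∉ A - A) ∧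
      ∀ x, ∃ t ∈ T, x + t ∈ A - A := by
  classical
  have hne : A.Nonempty := by
    rw [Set.nonempty_iff_ne_empty]
    rintro rfl
    refine hA.not_ge (Mstar_le_s19 (fun x => by simp)
      (convexCombTranslates_average _ (Finset.singleton_nonempty 0)) fun x => by simp)
  let S : Set ℕ := {n | ∃ T : Finset G,
    ((T : Set G).Pairwise fun s t => s - t ∉ A - A) ∧ T.card = n}
  have hbdd : BddAbove S := by
    refine ⟨⌊(Mstar (A.indicator fun _ => (1 : ℝ)))⁻¹⌋₊, ?_⟩
    rintro _ ⟨T, hT, rfl⟩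
    rcases T.eq_empty_or_nonempty with rfl | hTne
    · simp
    · have hpos : (0 : ℝ) < T.card := by exact_mod_cast hTne.card_pos
      exact Nat.le_floor ((le_inv_comm₀ hA hpos).1 (Mstar_indicator_le_inv_card hTne hT))
  obtain ⟨T, hT, hcard⟩ := Nat.sSup_mem (s := S) ⟨0, ∅, by simp, rfl⟩ hbdd
  refine ⟨T, hT, fun x => by_contra fun hx => ?_⟩
  push Not at hx
  have hneg : ∀ {y : G}, -y ∈ A - A → y ∈ A - A := fun {y} hy => by
    rwa [← Set.neg_mem_neg, neg_sub, neg_neg] at hy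
  have hxT : -x ∉ T := fun h => hx _ h <| by
    obtain ⟨a, ha⟩ := hne
    exact ⟨a, ha, a, ha, by simp⟩
  have hmem : T.card + 1 ∈ S := by
    refine ⟨insert (-x) T, ?_, Finset.card_insert_of_notMem hxT⟩
    rw [Finset.coe_insert]
    refine hT.insert fun t ht _ => ⟨fun h => hx t ht (hneg ?_), fun h => hx t ht ?_⟩
    · rwa [neg_add, ← sub_eq_add_neg]
    · rwa [sub_neg_eq_add, add_comm] at h
  have := le_csSup hbdd hmem
  omega

/-- if `A` has positive uppermost density then
`⌈1 / d_*(A−A)⌉ ≤ ⌊1 / d*(A)⌋`; consequently `d_*(A−A) ≥ d*(A)`. -/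
theorem stmt19 {G : Type*} [AddCommGroup G] [Infinite G] (A : Set G)
    (hA : 0 < Mstar (A.indicator fun _ => (1 : ℝ))) :
    ⌈1 / Mlowstar ((A - A).indicator fun _ => (1 : ℝ))⌉ ≤
      ⌊1 / Mstar (A.indicator fun _ => (1 : ℝ))⌋ ∧
    Mstar (A.indicator fun _ => (1 : ℝ)) ≤
      Mlowstar ((A - A).indicator fun _ => (1 : ℝ)) := by
  obtain ⟨T, hdisj, hcover⟩ := exists_disjoint_translates_covering hA
  have hT : T.Nonempty := let ⟨t, ht, _⟩ := hcover 0; ⟨t, ht⟩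
  have hpos : (0 : ℝ) < T.card := by exact_mod_cast hT.card_pos
  have hupper := Mstar_indicator_le_inv_card hT hdisj
  have hlower := inv_card_le_Mlowstar_indicator hT hcover
  refine ⟨?_, hupper.trans hlower⟩
  have hceil : ⌈1 / Mlowstar ((A - A).indicator fun _ => (1 : ℝ))⌉ ≤ (T.card : ℤ) := by
    rw [Int.ceil_le, one_div, Int.cast_natCast]
    exact inv_le_of_inv_le₀ hpos hlower
  refine hceil.trans ?_
  rw [Int.le_floor, one_div, Int.cast_natCast]
  exact (le_inv_comm₀ hA hpos).1 hupper
end
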